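/- Define polynomials P_m ∈ ℝ[x, v] by P_m(x, v) = Σ_{t ∈ I_m} x^{o(t)} v^{r(t)}, the sum over all 0-1-2-increasing trees of size m. Then P_1(x, v) = x, and for every m ≥ 1, P_{m+1} = (v + x)(1 − v)·∂P_m/∂v + x(v − 2x)·∂P_m/∂x + (m + 1)·x·P_m. -/

import Mathlib

/-- A 0-1-2-increasing tree of size `m`: vertices are `Fin m` (index `i`
represents label `i+1`, so index `0` is the root labelled `1`), encoded by a
parent function `f` with `f i < i` for every non-root vertex `i`
(and `f 0 = 0` by convention), such that every vertex has at most 2 children. -/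
abbrev IncTree (m : ℕ) : Type :=
  {f : Fin m → Fin m //
    (∀ i : Fin m, i.val = 0 → f i = i) ∧
    (∀ i : Fin m, i.val ≠ 0 → (f i).val < i.val) ∧
    (∀ j : Fin m, (Finset.univ.filter (fun i : Fin m => i.val ≠ 0 ∧ f i = j)).card ≤ 2)}

/-- The number of children of the vertex `j` in the tree `t`. -/
def numChildren {m : ℕ} (t : IncTree m) (j : Fin m) : ℕ :=
  (Finset.univ.filter (fun i : Fin m => i.val ≠ 0 ∧ t.val i = j)).card

/-- `o t`: the number of leaves (outdegree-0 vertices) of `t`. -/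
def numLeaves {m : ℕ} (t : IncTree m) : ℕ :=
  (Finset.univ.filter (fun j : Fin m => numChildren t j = 0)).card

/-- `r t`: the number of pitchforks of `t`, i.e. vertices with exactly one
child, that child being a leaf. -/
def numPitchforks {m : ℕ} (t : IncTree m) : ℕ :=
  (Finset.univ.filter (fun j : Fin m =>
    numChildren t j = 1 ∧
      ∀ i : Fin m, i.val ≠ 0 → t.val i = j → numChildren t i = 0)).card

open MvPolynomial

/-- `polyP m = Σ_{t ∈ I_m} x^{o t} v^{r t}` as a polynomial in `ℝ[x, v]`,
with `x = X 0` and `v = X 1`. -/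
noncomputable def polyP (m : ℕ) : MvPolynomial (Fin 2) ℝ :=
  ∑ t : IncTree m, X 0 ^ numLeaves t * X 1 ^ numPitchforks t

def extFun {m : ℕ} (f : Fin m → Fin m) (j : Fin m) : Fin (m + 1) → Fin (m + 1) :=
  Fin.lastCases j.castSucc (fun i => (f i).castSucc)

@[simp] lemma extFun_last {m : ℕ} (f : Fin m → Fin m) (j : Fin m) :
    extFun f j (Fin.last m) = j.castSucc := by simp [extFun]

@[simp] lemma extFun_castSucc {m : ℕ} (f : Fin m → Fin m) (j i : Fin m) :
    extFun f j i.castSucc = (f i).castSucc := by simp [extFun]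

lemma ext_card_castSucc {m : ℕ} (hm : 1 ≤ m) (f : Fin m → Fin m) (j k : Fin m) :
    (Finset.univ.filter (fun i : Fin (m+1) => i.val ≠ 0 ∧ extFun f j i = k.castSucc)).card
    = (Finset.univ.filter (fun i : Fin m => i.val ≠ 0 ∧ f i = k)).card
      + if j = k then 1 else 0 := by
  have : m ≠ 0 := by omega
  rw [Finset.card_filter, Fin.sum_univ_castSucc, Finset.card_filter]
  simp [this]

lemma ext_card_last {m : ℕ} (f : Fin m → Fin m) (j : Fin m) :
    (Finset.univ.filter (fun i : Fin (m+1) => i.val ≠ 0 ∧ extFun f j i = Fin.last m)).card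
    = 0 := by
  rw [Finset.card_filter, Fin.sum_univ_castSucc]
  simp

def extTree {m : ℕ} (hm : 1 ≤ m) (t : IncTree m) (j : Fin m) (hj : numChildren t j ≤ 1) :
    IncTree (m + 1) :=
  ⟨extFun t.val j, by
    refine ⟨?_, ?_, ?_⟩
    · intro i
      induction i using Fin.lastCases with
      | last => intro h; simp at h; omega
      | cast i => intro h; simp at h; simp [t.2.1 i (by simpa using h)]
    · intro i
      induction i using Fin.lastCases with
      | last => intro h; simp
      | cast i => intro h; simpa using t.2.2.1 i (by simpa using h)
    · intro k
      induction k using Fin.lastCases with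
      | last => rw [ext_card_last]; omega
      | cast k =>
        rw [ext_card_castSucc hm]
        have h := t.2.2.2 k
        unfold numChildren at hj
        split_ifs with e
        · subst e; omega
        · omega⟩

lemma nc_castSucc {m : ℕ} (hm : 1 ≤ m) (t : IncTree m) (j : Fin m) (hj : numChildren t j ≤ 1)
    (k : Fin m) : numChildren (extTree hm t j hj) k.castSucc
      = numChildren t k + if j = k then 1 else 0 := ext_card_castSucc hm t.val j k

lemma nc_last {m : ℕ} (hm : 1 ≤ m) (t : IncTree m) (j : Fin m) (hj : numChildren t j ≤ 1) :
    numChildren (extTree hm t j hj) (Fin.last m) = 0 := ext_card_last t.val j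

def isPF {m : ℕ} (t : IncTree m) (j : Fin m) : Prop :=
  numChildren t j = 1 ∧ ∀ i : Fin m, i.val ≠ 0 → t.val i = j → numChildren t i = 0

instance {m : ℕ} (t : IncTree m) : DecidablePred (isPF t) := fun j => by
  unfold isPF; infer_instance

lemma numPF_eq {m : ℕ} (t : IncTree m) :
    numPitchforks t = ∑ j : Fin m, if isPF t j then 1 else 0 := by
  rw [← Finset.card_filter]; rfl

lemma numLeaves_eq {m : ℕ} (t : IncTree m) :
    numLeaves t = ∑ j : Fin m, if numChildren t j = 0 then 1 else 0 := by
  rw [← Finset.card_filter]; rfl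

lemma leaves_ext {m : ℕ} (hm : 1 ≤ m) (t : IncTree m) (j : Fin m) (hj : numChildren t j ≤ 1) :
    numLeaves (extTree hm t j hj) + (if numChildren t j = 0 then 1 else 0) = numLeaves t + 1 := by
  rw [numLeaves_eq, numLeaves_eq, Fin.sum_univ_castSucc, nc_last]
  have : ∀ k, (if numChildren t k = 0 then 1 else 0)
      = (if numChildren (extTree hm t j hj) k.castSucc = 0 then 1 else 0)
        + if j = k then (if numChildren t k = 0 then 1 else 0) else 0 := by
    intro k
    rw [nc_castSucc]
    split_ifs <;> simp_all
  rw [Finset.sum_congr rfl (fun k _ => this k), Finset.sum_add_distrib]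
  simp
  omega

lemma pf_ext_last {m : ℕ} (hm : 1 ≤ m) (t : IncTree m) (j : Fin m) (hj : numChildren t j ≤ 1) :
    ¬ isPF (extTree hm t j hj) (Fin.last m) := by
  intro h
  have := h.1
  rw [nc_last] at this
  omega

lemma pf_ext_self {m : ℕ} (hm : 1 ≤ m) (t : IncTree m) (j : Fin m) (hj : numChildren t j ≤ 1) :
    isPF (extTree hm t j hj) j.castSucc ↔ numChildren t j = 0 := by
  constructor
  · intro h
    have := h.1
    rw [nc_castSucc] at this
    simpa using this
  · intro h
    refine ⟨by simp [nc_castSucc, h], ?_⟩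
    intro i
    induction i using Fin.lastCases with
    | last => intros; exact nc_last ..
    | cast i =>
      intro h0 h1
      exfalso
      have h1 : t.val i = j := by simpa [extTree] using h1
      unfold numChildren at h
      rw [Finset.card_eq_zero] at h
      have : i ∈ (∅ : Finset (Fin m)) := by
        rw [← h]; simp [h1]; simpa using h0
      simp at this

lemma pf_ext_ne {m : ℕ} (hm : 1 ≤ m) (t : IncTree m) (j : Fin m) (hj : numChildren t j ≤ 1)
    (k : Fin m) (hk : j ≠ k) :
    isPF (extTree hm t j hj) k.castSucc ↔ isPF t k ∧ ¬ (j.val ≠ 0 ∧ t.val j = k) := by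
  unfold isPF
  rw [nc_castSucc, if_neg hk, add_zero]
  constructor
  · rintro ⟨h1, h2⟩
    refine ⟨⟨h1, ?_⟩, ?_⟩
    · intro i h0 hi
      have := h2 i.castSucc (by simpa using h0) (by simp [extTree, hi])
      rw [nc_castSucc] at this
      omega
    · rintro ⟨h0, hi⟩
      have := h2 j.castSucc (by simpa using h0) (by simp [extTree, hi])
      rw [nc_castSucc] at this
      simp at this
  · rintro ⟨⟨h1, h2⟩, h3⟩
    refine ⟨h1, ?_⟩
    intro i
    induction i using Fin.lastCases with
    | last => intros; exact nc_last ..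
    | cast i =>
      intro h0 hi
      have h0 : i.val ≠ 0 := by simpa using h0
      have hi : t.val i = k := by simpa [extTree] using hi
      rw [nc_castSucc, h2 i h0 hi, if_neg]
      rintro rfl
      exact h3 ⟨h0, hi⟩

def inA {m : ℕ} (t : IncTree m) (j : Fin m) : Prop := j.val ≠ 0 ∧ isPF t (t.val j)

instance {m : ℕ} (t : IncTree m) : DecidablePred (inA t) := fun j => by
  unfold inA; infer_instance

lemma pf_ext {m : ℕ} (hm : 1 ≤ m) (t : IncTree m) (j : Fin m) (hj : numChildren t j ≤ 1) :
    numPitchforks (extTree hm t j hj) + (if isPF t j then 1 else 0) + (if inA t j then 1 else 0)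
      = numPitchforks t + (if numChildren t j = 0 then 1 else 0) := by
  rw [numPF_eq, numPF_eq, Fin.sum_univ_castSucc, if_neg (pf_ext_last hm t j hj)]
  have key : ∀ k, (if isPF (extTree hm t j hj) k.castSucc then 1 else 0)
        + (if j = k then (if isPF t k then 1 else 0) else 0)
        + (if t.val j = k then (if inA t j then 1 else 0) else 0)
      = (if isPF t k then 1 else 0)
        + (if j = k then (if numChildren t k = 0 then 1 else 0) else 0) := by
    intro k
    by_cases hk : j = k
    · subst hk
      have hne : t.val j = j → ¬ inA t j := by
        intro h h'
        have := t.2.2.1 j h'.1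
        rw [h] at this
        omega
      simp only [pf_ext_self]
      by_cases h : t.val j = j
      · simp [hne h]; omega
      · simp [h]; omega
    · simp only [pf_ext_ne hm t j hj k hk, if_neg hk]
      by_cases h : t.val j = k
      · subst h
        by_cases h0 : j.val = 0
        · simp [inA, h0]
        · simp [inA, h0]
      · simp [h]
  have := Finset.sum_congr rfl (fun k (_ : k ∈ Finset.univ) => key k)
  simp only [Finset.sum_add_distrib, Finset.sum_ite_eq, Finset.mem_univ, if_true] at this
  omega

lemma inA_leaf {m : ℕ} (t : IncTree m) (j : Fin m) (h : inA t j) : numChildren t j = 0 :=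
  h.2.2 j h.1 rfl

lemma sum_inA {m : ℕ} (t : IncTree m) :
    ∑ j : Fin m, (if inA t j then 1 else 0) = numPitchforks t := by
  have h1 : ∀ j, (if inA t j then 1 else 0)
      = ∑ k, if isPF t k then (if j.val ≠ 0 ∧ t.val j = k then 1 else 0) else 0 := by
    intro j
    rw [Finset.sum_eq_single (t.val j)]
    · unfold inA
      by_cases h0 : j.val = 0 <;> by_cases h1 : isPF t (t.val j) <;> simp [h0, h1]
    · intro b _ hb; simp [hb.symm]
    · simp
  rw [Finset.sum_congr rfl (fun j _ => h1 j), Finset.sum_comm, numPF_eq]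
  refine Finset.sum_congr rfl fun k _ => ?_
  split_ifs with h
  · rw [← Finset.card_filter]; exact h.1
  · simp

lemma sum_nc {m : ℕ} (hm : 1 ≤ m) (t : IncTree m) : ∑ k, numChildren t k + 1 = m := by
  unfold numChildren
  simp only [Finset.card_filter]
  rw [Finset.sum_comm]
  obtain ⟨n, rfl⟩ : ∃ n, m = n + 1 := ⟨m - 1, by omega⟩
  rw [Fin.sum_univ_succ]
  simp

lemma sum_one {m : ℕ} (hm : 1 ≤ m) (t : IncTree m) :
    ∑ j : Fin m, (if numChildren t j = 1 then 1 else 0) + 2 * numLeaves t = m + 1 := by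
  have h := sum_nc hm t
  have h2 : ∀ k, numChildren t k + 2 * (if numChildren t k = 0 then 1 else 0)
      + (if numChildren t k = 1 then 1 else 0) = 2 := by
    intro k
    have : numChildren t k ≤ 2 := t.2.2.2 k
    split_ifs <;> omega
  have h3 := Finset.sum_congr rfl (fun k (_ : k ∈ Finset.univ) => h2 k)
  simp only [Finset.sum_add_distrib, ← Finset.mul_sum, ← numLeaves_eq] at h3
  simp at h3 ⊢
  omega

noncomputable def wt {m : ℕ} (t : IncTree m) : MvPolynomial (Fin 2) ℝ :=
  X 0 ^ numLeaves t * X 1 ^ numPitchforks t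

lemma polyP_succ {m : ℕ} (hm : 1 ≤ m) :
    polyP (m + 1) = ∑ t : IncTree m, ∑ j : Fin m,
      if h : numChildren t j ≤ 1 then wt (extTree hm t j h) else 0 := by
  have h1 : ∀ t : IncTree m, ∑ j : Fin m,
      (if h : numChildren t j ≤ 1 then wt (extTree hm t j h) else 0)
      = ∑ j : {j : Fin m // numChildren t j ≤ 1}, wt (extTree hm t j.1 j.2) := by
    intro t
    set F : Fin m → MvPolynomial (Fin 2) ℝ := fun j =>
      if h : numChildren t j ≤ 1 then wt (extTree hm t j h) else 0 with hF
    have e1 : ∑ j : {j : Fin m // numChildren t j ≤ 1}, wt (extTree hm t j.1 j.2)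
        = ∑ j : {j : Fin m // numChildren t j ≤ 1}, F j.1 :=
      Finset.sum_congr rfl fun j _ => by simp only [hF]; rw [dif_pos j.2]
    rw [e1, ← Finset.sum_subtype (Finset.univ.filter fun j => numChildren t j ≤ 1) (by simp) F]
    symm
    apply Finset.sum_subset (Finset.subset_univ _)
    intro j _ hj
    simp only [hF]
    rw [dif_neg]
    simpa using hj
  rw [Finset.sum_congr rfl (fun t _ => h1 t), ← Fintype.sum_sigma']
  symm
  refine Fintype.sum_bijective (fun p : (Σ t : IncTree m, {j : Fin m // numChildren t j ≤ 1}) =>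
    extTree hm p.1 p.2.1 p.2.2) ⟨?_, ?_⟩ _ _ (fun _ => rfl)
  · rintro ⟨t, j, hj⟩ ⟨t', j', hj'⟩ h
    have h := congrArg Subtype.val h
    simp only [extTree] at h
    have e1 : j = j' := by
      have := congrFun h (Fin.last m)
      simpa using this
    have e2 : t = t' := by
      apply Subtype.ext
      funext i
      have := congrFun h i.castSucc
      simpa using this
    subst e1 e2
    rfl
  · intro g
    have hlt : ∀ i : Fin m, ∃ k : Fin m, g.val i.castSucc = k.castSucc := by
      intro i
      have : (g.val i.castSucc).val < m := by
        by_cases h : i.val = 0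
        · rw [g.2.1 _ (by simpa using h)]; simp
        · have := g.2.2.1 i.castSucc (by simpa using h)
          simp at this; omega
      exact ⟨⟨_, this⟩, rfl⟩
    choose f hf using hlt
    have : ∃ j : Fin m, g.val (Fin.last m) = j.castSucc :=
      ⟨⟨_, g.2.2.1 (Fin.last m) (by simp; omega)⟩, rfl⟩
    obtain ⟨j, hj⟩ := this
    have hg : g.val = extFun f j := by
      funext i
      induction i using Fin.lastCases with
      | last => simp [hj]
      | cast i => simp [hf]
    have hc : ∀ k, (Finset.univ.filter (fun i : Fin m => i.val ≠ 0 ∧ f i = k)).card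
      + (if j = k then 1 else 0) ≤ 2 := by
      intro k
      rw [← ext_card_castSucc hm, ← hg]
      exact g.2.2.2 _
    refine ⟨⟨⟨f, ?_, ?_, ?_⟩, j, ?_⟩, ?_⟩
    · intro i h
      have := g.2.1 i.castSucc (by simpa using h)
      rw [hf] at this
      simpa using this
    · intro i h
      have := g.2.2.1 i.castSucc (by simpa using h)
      rw [hf] at this
      simpa using this
    · intro k
      have := hc k
      omega
    · have := hc j
      simp only [if_true] at this
      unfold numChildren
      simp only
      omega
    · apply Subtype.ext
      exact hg.symm

lemma term_eq {m : ℕ} (hm : 1 ≤ m) (t : IncTree m) (j : Fin m) :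
    (if h : numChildren t j ≤ 1 then wt (extTree hm t j h) else 0)
    = wt t * ((if inA t j then 1 else 0 : ℕ) : MvPolynomial (Fin 2) ℝ)
    + wt t * X 1 * (((if numChildren t j = 0 then 1 else 0 : ℕ) : MvPolynomial (Fin 2) ℝ)
        - ((if inA t j then 1 else 0 : ℕ) : MvPolynomial (Fin 2) ℝ))
    + X 0 ^ (numLeaves t + 1) * X 1 ^ (numPitchforks t - 1)
        * ((if isPF t j then 1 else 0 : ℕ) : MvPolynomial (Fin 2) ℝ)
    + wt t * X 0 * (((if numChildren t j = 1 then 1 else 0 : ℕ) : MvPolynomial (Fin 2) ℝ)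
        - ((if isPF t j then 1 else 0 : ℕ) : MvPolynomial (Fin 2) ℝ)) := by
  have hA := inA_leaf t j
  have hP : isPF t j → numChildren t j = 1 := fun h => h.1
  by_cases h : numChildren t j ≤ 1
  · rw [dif_pos h]
    have h1 := leaves_ext hm t j h
    have h2 := pf_ext hm t j h
    unfold wt
    by_cases h0 : numChildren t j = 0
    · have hP' : ¬ isPF t j := fun h => by have := hP h; omega
      by_cases ha : inA t j
      · simp only [h0, ha, hP', if_true, if_false] at h1 h2 ⊢
        rw [show numLeaves (extTree hm t j h) = numLeaves t by omega,
          show numPitchforks (extTree hm t j h) = numPitchforks t by omega]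
        simp
      · simp only [h0, ha, hP', if_true, if_false] at h1 h2 ⊢
        rw [show numLeaves (extTree hm t j h) = numLeaves t by omega,
          show numPitchforks (extTree hm t j h) = numPitchforks t + 1 by omega]
        simp
        ring
    · have h3 : numChildren t j = 1 := by omega
      have ha : ¬ inA t j := fun h => h0 (hA h)
      by_cases hp : isPF t j
      · simp only [h0, h3, ha, hp, if_true, if_false] at h1 h2 ⊢
        simp at h1 h2
        rw [show numLeaves (extTree hm t j h) = numLeaves t + 1 by omega,
          show numPitchforks (extTree hm t j h) = numPitchforks t - 1 by omega]
        simp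
      · simp only [h0, h3, ha, hp, if_true, if_false] at h1 h2 ⊢
        simp at h1 h2
        rw [show numLeaves (extTree hm t j h) = numLeaves t + 1 by omega,
          show numPitchforks (extTree hm t j h) = numPitchforks t by omega]
        simp
        ring
  · rw [dif_neg h]
    have h0 : numChildren t j ≠ 0 := by omega
    have h1 : numChildren t j ≠ 1 := by omega
    have ha : ¬ inA t j := fun h => h0 (hA h)
    have hp : ¬ isPF t j := fun h => h1 (hP h)
    simp [h0, h1, ha, hp]

lemma polyP_one : polyP 1 = X 0 := by
  have : ∀ t : IncTree 1, X 0 ^ numLeaves t * X 1 ^ numPitchforks t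
      = (X 0 : MvPolynomial (Fin 2) ℝ) := by
    intro t
    have h : ∀ k, numChildren t k = 0 := by
      intro k; have := sum_nc le_rfl t; simp at this; rw [← this]; congr 1; exact Subsingleton.elim _ _
    have h1 : numLeaves t = 1 := by rw [numLeaves_eq]; simp [h]
    have h2 : numPitchforks t = 0 := by rw [numPF_eq]; simp [isPF, h]
    simp [h1, h2]
  unfold polyP
  rw [Finset.sum_congr rfl (fun t _ => this t)]
  have hc : Fintype.card (IncTree 1) = 1 := by decide
  simp [hc]

/-- `P_1 = x` and
`P_{m+1} = (v+x)(1−v)·∂P_m/∂v + x(v−2x)·∂P_m/∂x + (m+1)·x·P_m` for `m ≥ 1`. -/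
theorem polyP_recursion :
    polyP 1 = X 0 ∧
    ∀ m : ℕ, 1 ≤ m →
      polyP (m + 1) =
        (X 1 + X 0) * (1 - X 1) * (pderiv 1 (polyP m))
          + X 0 * (X 1 - 2 * X 0) * (pderiv 0 (polyP m))
          + ((m : ℝ) + 1) • (X 0 * polyP m) := by
  refine ⟨polyP_one, fun m hm => ?_⟩
  rw [polyP_succ hm]
  unfold polyP
  simp only [map_sum, Finset.mul_sum, Finset.smul_sum, ← Finset.sum_add_distrib]
  refine Finset.sum_congr rfl fun t _ => ?_
  rw [Finset.sum_congr rfl (fun j _ => term_eq hm t j)]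
  simp only [Finset.sum_add_distrib, ← Finset.mul_sum, Finset.sum_sub_distrib, ← Nat.cast_sum,
    ← numLeaves_eq, ← numPF_eq, sum_inA]
  have h1 := congrArg (Nat.cast : ℕ → MvPolynomial (Fin 2) ℝ) (sum_one hm t)
  rw [Nat.cast_add, ← eq_sub_iff_add_eq] at h1
  rw [h1]
  unfold wt
  have hs : ((m : ℝ) + 1) • (X 0 * (X 0 ^ numLeaves t * X 1 ^ numPitchforks t))
      = ((m : MvPolynomial (Fin 2) ℝ) + 1) * (X 0 * (X 0 ^ numLeaves t * X 1 ^ numPitchforks t)) := by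
    rw [MvPolynomial.smul_eq_C_mul]; simp
  rw [hs]
  simp only [Derivation.leibniz, Derivation.leibniz_pow, pderiv_X_self, smul_eq_mul, nsmul_eq_mul]
  rw [pderiv_X_of_ne (by decide), pderiv_X_of_ne (by decide)]
  push_cast
  generalize numLeaves t = o
  generalize numPitchforks t = r
  rcases o with _ | o <;> rcases r with _ | r <;> simp <;> ring
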